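/- Let k be an algebraically closed field of characteristic zero, n ≥ 3, d ≥ 1, and let a, b ∈ ℕ with a + b ≤ d − 1. Set t* = ⌈C(d+n,n)/(d+1)⌉ and let c* ≥ t* − 2(a+b). Suppose statement S*(n,d) holds, i.e., there exist in P^n sundials Ĉ_1,…,Ĉ_{d−1} and lines M_1,…,M_{t*−2(d−1)} whose combined ideal I satisfies dim (I)_d = 0. Then there exist in P^n sundials Ĉ_1,…,Ĉ_a, degenerate conics D_1,…,D_b, points R_1,…,R_b, and lines M_1,…,M_{c*} whose combined ideal I' satisfies dim (I')_d = 0. -/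

import Mathlib

open MvPolynomial

noncomputable def vanIdeal (k : Type) [Field k] (N : ℕ) (V : Set (Fin N → k)) :
    Ideal (MvPolynomial (Fin N) k) where
  carrier := {f | ∀ v ∈ V, MvPolynomial.eval v f = 0}
  add_mem' := by
    intro f g hf hg v hv
    simp only [Set.mem_setOf_eq] at *
    simp [map_add, hf v hv, hg v hv]
  zero_mem' := by
    intro v hv
    simp
  smul_mem' := by
    intro c f hf v hv
    simp only [Set.mem_setOf_eq] at *
    simp [smul_eq_mul, hf v hv]

noncomputable def hdim (k : Type) [Field k] (N : ℕ)
    (I : Ideal (MvPolynomial (Fin N) k)) (d : ℕ) : ℕ :=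
  Module.finrank k
    ↥(Submodule.restrictScalars k
        (I : Submodule (MvPolynomial (Fin N) k) (MvPolynomial (Fin N) k))
      ⊓ MvPolynomial.homogeneousSubmodule (Fin N) k d)

/-- A 3-dimensional sundial: two distinct lines `V₁ ≠ V₂` meeting in a point
`P = V₁ ⊓ V₂`, together with a 4-dimensional subspace `T ⊇ V₁ ⊔ V₂`. -/
def IsSundial (k : Type) [Field k] (N : ℕ)
    (V₁ V₂ T : Submodule k (Fin N → k)) : Prop :=
  Module.finrank k V₁ = 2 ∧ Module.finrank k V₂ = 2 ∧ V₁ ≠ V₂ ∧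
    Module.finrank k ↥(V₁ ⊓ V₂) = 1 ∧ V₁ ⊔ V₂ ≤ T ∧ Module.finrank k T = 4

/-- The ideal `I(V₁) ∩ I(V₂) ∩ (I(P)² + I(T))` of a 3-dimensional sundial. -/
noncomputable def sundialIdeal (k : Type) [Field k] (N : ℕ)
    (V₁ V₂ T : Submodule k (Fin N → k)) : Ideal (MvPolynomial (Fin N) k) :=
  vanIdeal k N ↑V₁ ⊓ vanIdeal k N ↑V₂ ⊓
    ((vanIdeal k N ↑(V₁ ⊓ V₂)) ^ 2 + vanIdeal k N ↑T)

/-- The degree `d` part of `I` vanishes. -/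
def ZeroIn {k : Type} [Field k] {N : ℕ} (d : ℕ) (I : Ideal (MvPolynomial (Fin N) k)) : Prop :=
  ∀ f ∈ I, f.IsHomogeneous d → f = 0

theorem hdim_zero_iff {k : Type} [Field k] {N : ℕ} (d : ℕ)
    (I : Ideal (MvPolynomial (Fin N) k)) : hdim k N I d = 0 ↔ ZeroIn d I := by
  unfold hdim
  have hfg : FiniteDimensional k (homogeneousSubmodule (Fin N) k d) :=
    Module.Finite.iff_fg.mpr (homogeneousSubmodule_fg (σ := Fin N) (R := k) d)
  have : FiniteDimensional k ↥(Submodule.restrictScalars k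
        (I : Submodule (MvPolynomial (Fin N) k) (MvPolynomial (Fin N) k))
      ⊓ MvPolynomial.homogeneousSubmodule (Fin N) k d) :=
    Submodule.finiteDimensional_of_le inf_le_right
  rw [Submodule.finrank_eq_zero, Submodule.eq_bot_iff]
  constructor
  · intro h f hf hd
    exact h f ⟨hf, hd⟩
  · intro h f hf
    exact h f hf.1 hf.2

theorem ZeroIn.mono {k : Type} [Field k] {N : ℕ} {d : ℕ} {I J : Ideal (MvPolynomial (Fin N) k)}
    (h : ZeroIn d J) (hIJ : I ≤ J) : ZeroIn d I :=
  fun f hf hd => h f (hIJ hf) hd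

theorem iterate_replace {k : Type} [Field k] {N : ℕ} {d : ℕ} {X : Type*} (m : ℕ)
    (J : Fin m → Ideal (MvPolynomial (Fin N) k))
    (J' : Fin m → X → Ideal (MvPolynomial (Fin N) k)) (Q : X → Prop)
    (H : ∀ i K, ZeroIn d (J i ⊓ K) → ∃ x, Q x ∧ ZeroIn d (J' i x ⊓ K)) :
    ∀ K, ZeroIn d ((⨅ i, J i) ⊓ K) →
      ∃ x : Fin m → X, (∀ i, Q (x i)) ∧ ZeroIn d ((⨅ i, J' i (x i)) ⊓ K) := by
  induction m with
  | zero =>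
    intro K hK
    refine ⟨fun i => i.elim0, fun i => i.elim0, ?_⟩
    refine hK.mono ?_
    simp
  | succ m ih =>
    intro K hK
    obtain ⟨x0, hx0, h0⟩ := H 0 ((⨅ i : Fin m, J i.succ) ⊓ K) (hK.mono (by
      refine le_inf (le_iInf fun i => ?_) (inf_le_right.trans inf_le_right)
      refine Fin.cases ?_ (fun j => ?_) i
      · exact inf_le_left
      · exact inf_le_right.trans (inf_le_left.trans (iInf_le _ j))))
    obtain ⟨x, hx, h1⟩ := ih (fun i => J i.succ) (fun i => J' i.succ)
      (fun i K => H i.succ K) (J' 0 x0 ⊓ K) (h0.mono (by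
        refine le_inf (inf_le_right.trans inf_le_left) (le_inf inf_le_left
          (inf_le_right.trans inf_le_right))))
    refine ⟨Fin.cons x0 x, fun i => ?_, h1.mono ?_⟩
    · refine Fin.cases ?_ (fun j => ?_) i
      · simpa using hx0
      · simpa using hx j
    · refine le_inf (le_iInf fun i => ?_) (le_inf ?_ inf_le_right)
      · refine inf_le_left.trans ((iInf_le _ i.succ).trans ?_)
        simp
      · refine inf_le_left.trans ((iInf_le _ 0).trans ?_)
        simp

/-- Semicontinuity in a one-parameter family of linear conditions. -/
theorem semicont {k : Type} [Field k] [CharZero k] {W : Type*} [AddCommGroup W] [Module k W]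
    [FiniteDimensional k W] {ι : Type*} (Φ : ι → W →ₗ[k] Polynomial k)
    (h0 : ∀ f, (∀ i, (Φ i f).eval 0 = 0) → f = 0) :
    ∃ t : k, t ≠ 0 ∧ ∀ f, (∀ i, (Φ i f).eval t = 0) → f = 0 := by
  classical
  let φ : ι → Module.Dual k W := fun i => (Polynomial.leval 0).comp (Φ i)
  have hspan : Submodule.span k (Set.range φ) = ⊤ := by
    have hbot : (Submodule.span k (Set.range φ)).dualCoannihilator = ⊥ := by
      rw [Submodule.eq_bot_iff]
      intro f hf
      rw [Submodule.mem_dualCoannihilator] at hf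
      exact h0 f fun i => hf (φ i) (Submodule.subset_span ⟨i, rfl⟩)
    have := Subspace.finrank_add_finrank_dualCoannihilator_eq (Submodule.span k (Set.range φ))
    rw [hbot, finrank_bot, add_zero] at this
    apply Submodule.eq_top_of_finrank_eq
    rw [this, Subspace.dual_finrank_eq]
  have key : ∀ g : Module.Dual k W, ∃ Ψ : W →ₗ[k] Polynomial k, (∀ f, (Ψ f).eval 0 = g f) ∧
      ∀ t f, (∀ i, (Φ i f).eval t = 0) → (Ψ f).eval t = 0 := by
    intro g
    have hg : g ∈ Submodule.span k (Set.range φ) := by rw [hspan]; trivial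
    induction hg using Submodule.span_induction with
    | mem x hx =>
      obtain ⟨i, rfl⟩ := hx
      exact ⟨Φ i, fun f => rfl, fun t f h => h i⟩
    | zero => exact ⟨0, by simp, by simp⟩
    | add x y _ _ hx hy =>
      obtain ⟨A, hA, hA'⟩ := hx
      obtain ⟨B, hB, hB'⟩ := hy
      exact ⟨A + B, by simp [hA, hB], fun t f h => by simp [hA' t f h, hB' t f h]⟩
    | smul c x _ hx =>
      obtain ⟨A, hA, hA'⟩ := hx
      exact ⟨c • A, by simp [hA], fun t f h => by simp [hA' t f h]⟩
  let bs := Module.finBasis k W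
  choose Ψ hΨ hΨ' using fun a => key (bs.coord a)
  let M : Matrix (Fin (Module.finrank k W)) (Fin (Module.finrank k W)) (Polynomial k) :=
    fun a c => Ψ a (bs c)
  have hev : ∀ t, M.det.eval t = Matrix.det (fun a c => (M a c).eval t) := by
    intro t
    have := RingHom.map_det (Polynomial.evalRingHom t) M
    exact this
  have hdet0 : M.det.eval 0 = 1 := by
    rw [hev]
    have : (fun a c => (M a c).eval 0) = (1 : Matrix (Fin (Module.finrank k W)) _ k) := by
      ext a c
      simp [M, hΨ, Matrix.one_apply, Finsupp.single_apply, eq_comm]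
    rw [this, Matrix.det_one]
  have hne : Polynomial.X * M.det ≠ 0 := by
    refine mul_ne_zero Polynomial.X_ne_zero ?_
    intro h
    rw [h] at hdet0
    simp at hdet0
  obtain ⟨t, ht⟩ : ∃ t, (Polynomial.X * M.det).eval t ≠ 0 := by
    by_contra! hcon
    exact hne (Polynomial.funext (by simpa using hcon))
  rw [Polynomial.eval_mul, Polynomial.eval_X] at ht
  refine ⟨t, left_ne_zero_of_mul ht, fun f hf => ?_⟩
  have hd := right_ne_zero_of_mul ht
  rw [hev] at hd
  have hx : Matrix.mulVec (fun a c => (M a c).eval t) (bs.repr f) = 0 := by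
    ext a
    have h1 := hΨ' a t f hf
    conv at h1 => lhs; rw [← bs.sum_repr f]
    simp only [map_sum, map_smul, Polynomial.eval_finsetSum, Polynomial.eval_smul,
      smul_eq_mul] at h1
    simp only [Matrix.mulVec, dotProduct, Pi.zero_apply]
    rw [← h1]
    exact Finset.sum_congr rfl fun c _ => mul_comm _ _
  have := Matrix.eq_zero_of_mulVec_eq_zero hd hx
  apply bs.repr.injective
  ext a
  simpa using congrFun this a

/-- First order Taylor expansion. -/
theorem taylor_mem {k A : Type*} [Field k] [CommRing A] [Algebra k A] {N : ℕ} (J : Ideal A)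
    (x y : Fin N → A) (hy : ∀ j, y j ∈ J) (f : MvPolynomial (Fin N) k) :
    aeval (fun j => x j + y j) f - aeval x f - ∑ j, aeval x (pderiv j f) * y j ∈ J ^ 2 := by
  induction f using MvPolynomial.induction_on with
  | C c => simp
  | add f g hf hg =>
    convert add_mem hf hg using 1
    simp only [map_add, add_mul, Finset.sum_add_distrib]
    ring
  | mul_X f i hf =>
    have e : aeval (fun j => x j + y j) (f * X i) - aeval x (f * X i)
        - ∑ j, aeval x (pderiv j (f * X i)) * y j
        = (aeval (fun j => x j + y j) f - aeval x f - ∑ j, aeval x (pderiv j f) * y j)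
            * (x i + y i) + (∑ j, aeval x (pderiv j f) * y j) * y i := by
      have : ∑ j, aeval x (pderiv j (f * X i)) * y j
          = (∑ j, aeval x (pderiv j f) * y j) * x i + aeval x f * y i := by
        have h2 : ∀ j, aeval x (pderiv j (f * X i)) * y j
          = (aeval x (pderiv j f) * y j) * x i + (if j = i then aeval x f * y i else 0) := by
          intro j
          rw [pderiv_mul, pderiv_X]
          by_cases h : j = i
          · subst h; simp; ring
          · simp [h, Ne.symm h]; ring
        simp_rw [h2]
        rw [Finset.sum_add_distrib, Finset.sum_mul]
        simp
      rw [this]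
      simp only [map_mul, aeval_X]
      ring
    rw [e]
    refine add_mem (Ideal.mul_mem_right _ _ hf) ?_
    rw [pow_two]
    exact Ideal.mul_mem_mul (Ideal.sum_mem _ fun j _ => Ideal.mul_mem_left _ _ (hy j)) (hy i)

theorem aeval_scale {k A : Type*} [Field k] [CommRing A] [Algebra k A] {N d : ℕ}
    (f : MvPolynomial (Fin N) k) (hf : f.IsHomogeneous d) (c : A) (p : Fin N → k) :
    aeval (fun j => c * algebraMap k A (p j)) f = c ^ d * algebraMap k A (eval p f) := by
  conv_lhs => rw [f.as_sum]
  rw [eval_eq, map_sum, map_sum, Finset.mul_sum]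
  refine Finset.sum_congr rfl fun m hm => ?_
  have hdeg : m.degree = d := by
    have := hf (mem_support_iff.mp hm)
    rwa [Finsupp.degree_eq_weight_one]
  rw [aeval_monomial, Finsupp.prod, map_mul, map_prod]
  simp_rw [mul_pow, Finset.prod_mul_distrib, map_pow, Finset.prod_pow_eq_pow_sum]
  rw [← hdeg, Finsupp.degree_apply]
  ring

/-- Restriction of `f` to the parametrised line `p + t z`. -/
noncomputable def lineMap {k : Type} [Field k] {N : ℕ} (p z : Fin N → k) :
    MvPolynomial (Fin N) k →ₐ[k] Polynomial k :=
  aeval (fun j => Polynomial.C (p j) + Polynomial.C (z j) * Polynomial.X)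

theorem lineMap_eval {k : Type} [Field k] {N : ℕ} (p z : Fin N → k)
    (f : MvPolynomial (Fin N) k) (t : k) :
    (lineMap p z f).eval t = eval (p + t • z) f := by
  have : ((Polynomial.aeval t).comp (lineMap p z)) = (aeval (p + t • z) : _ →ₐ[k] k) := by
    apply MvPolynomial.algHom_ext
    intro i
    simp [lineMap]
    ring
  have := DFunLike.congr_fun this f
  simpa [Polynomial.aeval_def, Polynomial.eval₂_eq_eval_map, MvPolynomial.aeval_eq_eval] using this

theorem lineMap_coeff_one {k : Type} [Field k] {N : ℕ} (p z : Fin N → k)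
    (f : MvPolynomial (Fin N) k) :
    (lineMap p z f).coeff 1 = ∑ j, eval p (pderiv j f) * z j := by
  have h := taylor_mem (A := Polynomial k) (Ideal.span {Polynomial.X})
    (fun j => Polynomial.C (p j)) (fun j => Polynomial.C (z j) * Polynomial.X)
    (fun j => Ideal.mul_mem_left _ _ (Ideal.mem_span_singleton_self _)) f
  rw [Ideal.span_singleton_pow, Ideal.mem_span_singleton, Polynomial.X_pow_dvd_iff] at h
  have h1 := h 1 (by norm_num)
  have hC : ∀ g : MvPolynomial (Fin N) k,
      aeval (fun j => (Polynomial.C (p j) : Polynomial k)) g = Polynomial.C (eval p g) := by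
    intro g
    have : (aeval (fun j => (Polynomial.C (p j) : Polynomial k)) : _ →ₐ[k] _)
        = (Algebra.ofId k (Polynomial k)).comp (aeval p) := by
      apply MvPolynomial.algHom_ext
      intro i
      simp [Algebra.ofId_apply]
    rw [this]
    simp [Algebra.ofId_apply, MvPolynomial.aeval_eq_eval]
  simp only [hC] at h1
  rw [Polynomial.coeff_sub, Polynomial.coeff_sub, Polynomial.coeff_C, Polynomial.finsetSum_coeff]
    at h1
  simp only [← mul_assoc, ← Polynomial.C_mul, Polynomial.coeff_C_mul, Polynomial.coeff_X_one,
    mul_one] at h1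
  simpa [sub_eq_zero, lineMap] using h1

/-- The linear form attached to a functional. -/
noncomputable def linForm {k : Type} [Field k] {N : ℕ} (φ : (Fin N → k) →ₗ[k] k) :
    MvPolynomial (Fin N) k := ∑ j, C (φ (Pi.single j 1)) * X j

theorem eval_linForm {k : Type} [Field k] {N : ℕ} (φ : (Fin N → k) →ₗ[k] k) (v : Fin N → k) :
    eval v (linForm φ) = φ v := by
  simp only [linForm, map_sum, map_mul, eval_C, eval_X]
  conv_rhs => rw [LinearMap.pi_apply_eq_sum_univ φ v]
  refine Finset.sum_congr rfl fun j _ => ?_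
  rw [smul_eq_mul, mul_comm]
  congr 2
  ext i
  simp [Pi.single_apply, eq_comm]

theorem dirDeriv_zero {k : Type} [Field k] [CharZero k] {N : ℕ} (p z : Fin N → k)
    (f : MvPolynomial (Fin N) k) (h : ∀ t : k, eval (p + t • z) f = 0) :
    ∑ j, eval p (pderiv j f) * z j = 0 := by
  rw [← lineMap_coeff_one]
  have : lineMap p z f = 0 := Polynomial.funext fun t => by rw [lineMap_eval, h]; simp
  rw [this]; simp

theorem mem_sq_add {k : Type} [Field k] [CharZero k] {N d : ℕ} (b : Fin 4 → Fin N → k)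
    (hb : LinearIndependent k b) (f : MvPolynomial (Fin N) k) (hf : f.IsHomogeneous d)
    (h1 : ∀ t : k, eval (b 0 + t • b 1) f = 0) (h2 : ∀ t : k, eval (b 0 + t • b 2) f = 0)
    (h3 : (lineMap (b 0) (b 3) f).coeff 1 = 0) :
    f ∈ (vanIdeal k N ↑(Submodule.span k {b 0})) ^ 2
      + vanIdeal k N ↑(Submodule.span k (Set.range b)) := by
  set T := Submodule.span k (Set.range b) with hT
  set I := vanIdeal k N ↑(Submodule.span k {b 0}) with hI
  have hbT : ∀ i, b i ∈ T := fun i => Submodule.subset_span ⟨i, rfl⟩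
  obtain ⟨π, hπ⟩ := T.exists_isCompl.elim fun Q hQ =>
    LinearMap.exists_leftInverse_of_injective T.subtype T.ker_subtype
  have hπ' : ∀ x : T, π x = x := fun x => LinearMap.congr_fun hπ x
  let bs := Module.Basis.span hb
  have hbs : ∀ i, π (b i) = bs i := by
    intro i
    have : (bs i : Fin N → k) = b i := congrArg Subtype.val (Module.Basis.span_apply hb i)
    rw [← this]; exact hπ' _
  let α : Fin 4 → (Fin N → k) →ₗ[k] k := fun i => (bs.coord i).comp π
  have hα : ∀ i j, α i (b j) = if i = j then 1 else 0 := by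
    intro i j
    simp [α, hbs, Finsupp.single_apply, eq_comm]
  let ρ : Fin N → (Fin N → k) →ₗ[k] k := fun j =>
    (LinearMap.proj j).comp (LinearMap.id - T.subtype.comp π)
  have hρ : ∀ j, ∀ v ∈ T, ρ j v = 0 := by
    intro j v hv
    have := hπ' ⟨v, hv⟩
    simp [ρ, show π v = ⟨v, hv⟩ from this]
  have hdecomp : ∀ v j, v j = ∑ i, α i v * b i j + ρ j v := by
    intro v j
    have h := bs.sum_repr (π v)
    have h' := congrArg (fun x : T => (x : Fin N → k) j) h
    have hb' : ∀ i, (bs i : Fin N → k) = b i := fun i => congrArg Subtype.val (Module.Basis.span_apply hb i)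
    simp only [AddSubmonoidClass.coe_finsetSum, Submodule.coe_smul, hb', Finset.sum_apply,
      Pi.smul_apply, smul_eq_mul] at h'
    simp [α, ρ, h']
  let L : Fin 4 → MvPolynomial (Fin N) k := fun i => linForm (α i)
  let x : Fin N → MvPolynomial (Fin N) k := fun j => L 0 * C (b 0 j)
  let y : Fin N → MvPolynomial (Fin N) k := fun j =>
    L 1 * C (b 1 j) + L 2 * C (b 2 j) + L 3 * C (b 3 j) + linForm (ρ j)
  have hxy : (fun j => x j + y j) = X := by
    funext j
    apply MvPolynomial.funext
    intro v
    have := hdecomp v j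
    rw [Fin.sum_univ_four] at this
    simp only [x, y, L, map_add, map_mul, eval_linForm, eval_C, eval_X]
    rw [this]; ring
  have hker : ∀ φ : (Fin N → k) →ₗ[k] k, φ (b 0) = 0 → linForm φ ∈ I := by
    intro φ hφ v hv
    obtain ⟨c, rfl⟩ := Submodule.mem_span_singleton.mp hv
    rw [eval_linForm]; simp [hφ]
  have hy : ∀ j, y j ∈ I := by
    intro j
    refine add_mem (add_mem (add_mem ?_ ?_) ?_) (hker _ (hρ j _ (hbT 0)))
    all_goals exact Ideal.mul_mem_right _ _ (hker _ (by simp [hα]))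
  have hTay := taylor_mem I x y hy f
  rw [hxy, aeval_X_left_apply] at hTay
  have hx0 : aeval x f = 0 := by
    have := aeval_scale (A := MvPolynomial (Fin N) k) f hf (L 0) (b 0)
    rw [algebraMap_eq] at this
    have h0 := h1 0
    simp only [zero_smul, add_zero] at h0
    rw [h0, map_zero, mul_zero] at this
    exact this
  have hxd : ∀ j, aeval x (pderiv j f) = L 0 ^ (d - 1) * C (eval (b 0) (pderiv j f)) := by
    intro j
    exact aeval_scale (A := MvPolynomial (Fin N) k) _ hf.pderiv (L 0) (b 0)
  have e1 := dirDeriv_zero _ _ _ h1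
  have e2 := dirDeriv_zero _ _ _ h2
  rw [lineMap_coeff_one] at h3
  have hs : ∑ j, aeval x (pderiv j f) * y j
      = ∑ j, aeval x (pderiv j f) * linForm (ρ j) := by
    have : ∑ j, aeval x (pderiv j f) * y j = ∑ j, aeval x (pderiv j f) * linForm (ρ j)
        + L 0 ^ (d-1) * (L 1 * C (∑ j, eval (b 0) (pderiv j f) * b 1 j)
          + L 2 * C (∑ j, eval (b 0) (pderiv j f) * b 2 j)
          + L 3 * C (∑ j, eval (b 0) (pderiv j f) * b 3 j)) := by
      simp only [map_sum, Finset.mul_sum, ← Finset.sum_add_distrib, hxd, y, map_mul]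
      refine Finset.sum_congr rfl fun j _ => ?_
      ring
    rw [this, e1, e2, h3]
    simp
  rw [hx0, hs, sub_zero] at hTay
  have hmem : ∑ j, aeval x (pderiv j f) * linForm (ρ j) ∈ vanIdeal k N ↑T := by
    refine Ideal.sum_mem _ fun j _ => Ideal.mul_mem_left _ _ ?_
    intro v hv
    rw [eval_linForm]; exact hρ j v hv
  have := Submodule.add_mem_sup hTay hmem
  simpa using this

theorem finrank_pair {k : Type} [Field k] {N : ℕ} {x y : Fin N → k}
    (h : LinearIndependent k ![x, y]) : Module.finrank k (Submodule.span k {x, y}) = 2 := by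
  have h2 := finrank_span_eq_card h
  rw [Matrix.range_cons_cons_empty] at h2
  simpa using h2

theorem sundial_basis {k : Type} [Field k] {N : ℕ} {V₁ V₂ T : Submodule k (Fin N → k)}
    (h : IsSundial k N V₁ V₂ T) : ∃ b : Fin 4 → Fin N → k, LinearIndependent k b ∧
      V₁ = Submodule.span k {b 0, b 1} ∧ V₂ = Submodule.span k {b 0, b 2} ∧
      V₁ ⊓ V₂ = Submodule.span k {b 0} ∧ T = Submodule.span k (Set.range b) := by
  obtain ⟨f1, f2, hne, fi, hT, fT⟩ := h
  have hsum := Submodule.finrank_sup_add_finrank_inf_eq V₁ V₂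
  obtain ⟨u, hu1, hu2⟩ : ∃ u ∈ V₁, u ∉ V₂ := by
    by_contra! hc
    exact hne (Submodule.eq_of_le_of_finrank_eq hc (by rw [f1, f2]))
  obtain ⟨w, hw2, hw1⟩ : ∃ w ∈ V₂, w ∉ V₁ := by
    by_contra! hc
    exact hne (Submodule.eq_of_le_of_finrank_eq hc (by rw [f1, f2])).symm
  obtain ⟨z, hzT, hz⟩ : ∃ z ∈ T, z ∉ V₁ ⊔ V₂ := by
    by_contra! hc
    have := Submodule.finrank_mono hc
    omega
  obtain ⟨p, hp, hp0⟩ : ∃ p ∈ V₁ ⊓ V₂, p ≠ 0 := by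
    by_contra! hc
    have : V₁ ⊓ V₂ = ⊥ := (Submodule.eq_bot_iff _).mpr hc
    rw [this] at fi
    simp at fi
  have hli : LinearIndependent k ![p, u, w, z] := by
    rw [Fintype.linearIndependent_iff]
    intro g hg
    simp [Fin.sum_univ_four] at hg
    have g3 : g 3 = 0 := by
      by_contra hc
      apply hz
      have : z = (g 3)⁻¹ • (-(g 0 • p + g 1 • u + g 2 • w)) := by
        rw [eq_inv_smul_iff₀ hc]
        exact (neg_eq_of_add_eq_zero_right hg).symm
      rw [this]
      exact Submodule.smul_mem _ _ (neg_mem (add_mem (add_mem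
        (Submodule.smul_mem _ _ (Submodule.mem_sup_left hp.1))
        (Submodule.smul_mem _ _ (Submodule.mem_sup_left hu1)))
        (Submodule.smul_mem _ _ (Submodule.mem_sup_right hw2))))
    simp [g3] at hg
    have g2 : g 2 = 0 := by
      by_contra hc
      apply hw1
      have : w = (g 2)⁻¹ • (-(g 0 • p + g 1 • u)) := by
        rw [eq_inv_smul_iff₀ hc]
        exact (neg_eq_of_add_eq_zero_right hg).symm
      rw [this]
      exact Submodule.smul_mem _ _ (neg_mem (add_mem
        (Submodule.smul_mem _ _ hp.1) (Submodule.smul_mem _ _ hu1)))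
    simp [g2] at hg
    have g1 : g 1 = 0 := by
      by_contra hc
      apply hu2
      have : u = (g 1)⁻¹ • (-(g 0 • p)) := by
        rw [eq_inv_smul_iff₀ hc]
        exact (neg_eq_of_add_eq_zero_right hg).symm
      rw [this]
      exact Submodule.smul_mem _ _ (neg_mem (Submodule.smul_mem _ _ hp.2))
    simp [g1, hp0] at hg
    intro i
    fin_cases i <;> assumption
  refine ⟨![p, u, w, z], hli, ?_, ?_, ?_, ?_⟩
  · symm
    apply Submodule.eq_of_le_of_finrank_eq
    · rw [Submodule.span_le]
      rintro x (rfl | rfl)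
      exacts [hp.1, hu1]
    · have := hli.comp ![0, 1] (by decide)
      have h2 : LinearIndependent k ![p, u] := by
        convert this using 1
        ext i
        fin_cases i <;> rfl
      rw [f1]
      exact finrank_pair h2
  · symm
    apply Submodule.eq_of_le_of_finrank_eq
    · rw [Submodule.span_le]
      rintro x (rfl | rfl)
      exacts [hp.2, hw2]
    · have := hli.comp ![0, 2] (by decide)
      have h2 : LinearIndependent k ![p, w] := by
        convert this using 1
        ext i
        fin_cases i <;> rfl
      rw [f2]
      exact finrank_pair h2
  · symm
    apply Submodule.eq_of_le_of_finrank_eq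
    · rw [Submodule.span_le]
      rintro x rfl
      exact hp
    · rw [fi]
      exact finrank_span_singleton hp0
  · symm
    apply Submodule.eq_of_le_of_finrank_eq
    · rw [Submodule.span_le]
      rintro x ⟨i, rfl⟩
      have h1 := (le_sup_left.trans hT) hp.1
      have h2 := (le_sup_left.trans hT) hu1
      have h3 := (le_sup_right.trans hT) hw2
      fin_cases i <;> assumption
    · rw [fT, finrank_span_eq_card hli]; simp

/-- Membership criterion for the sundial ideal. -/
theorem mem_sundial {k : Type} [Field k] [CharZero k] {N d : ℕ}
    {V₁ V₂ T : Submodule k (Fin N → k)} {b : Fin 4 → Fin N → k} (hb : LinearIndependent k b)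
    (e1 : V₁ = Submodule.span k {b 0, b 1}) (e2 : V₂ = Submodule.span k {b 0, b 2})
    (e0 : V₁ ⊓ V₂ = Submodule.span k {b 0}) (eT : T = Submodule.span k (Set.range b))
    (f : MvPolynomial (Fin N) k) (hf : f.IsHomogeneous d)
    (h1 : f ∈ vanIdeal k N ↑V₁) (h2 : f ∈ vanIdeal k N ↑V₂)
    (h3 : (lineMap (b 0) (b 3) f).coeff 1 = 0) : f ∈ sundialIdeal k N V₁ V₂ T := by
  refine ⟨⟨h1, h2⟩, ?_⟩
  rw [e0, eT]
  refine mem_sq_add b hb f hf (fun t => h1 _ ?_) (fun t => h2 _ ?_) h3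
  · rw [e1]
    exact add_mem (Submodule.subset_span (by simp))
      (Submodule.smul_mem _ _ (Submodule.subset_span (by simp)))
  · rw [e2]
    exact add_mem (Submodule.subset_span (by simp))
      (Submodule.smul_mem _ _ (Submodule.subset_span (by simp)))

theorem sundial_to_conic {k : Type} [Field k] [CharZero k] {N d : ℕ} (hd : 1 ≤ d)
    {V₁ V₂ T : Submodule k (Fin N → k)} (hs : IsSundial k N V₁ V₂ T)
    (K : Ideal (MvPolynomial (Fin N) k)) (hK : ZeroIn d (sundialIdeal k N V₁ V₂ T ⊓ K)) :
    ∃ R : Submodule k (Fin N → k), Module.finrank k R = 1 ∧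
      ZeroIn d ((vanIdeal k N ↑V₁ ⊓ vanIdeal k N ↑V₂ ⊓ vanIdeal k N ↑R) ⊓ K) := by
  obtain ⟨b, hb, e1, e2, e0, eT⟩ := sundial_basis hs
  set ψ : MvPolynomial (Fin N) k → k := fun f => (lineMap (b 0) (b 3) f).coeff 1 with hψ
  by_cases hz : ZeroIn d (vanIdeal k N ↑V₁ ⊓ vanIdeal k N ↑V₂ ⊓ K)
  · refine ⟨Submodule.span k {b 0}, finrank_span_singleton (hb.ne_zero 0), hz.mono ?_⟩
    exact le_inf (inf_le_left.trans inf_le_left) inf_le_right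
  · unfold ZeroIn at hz
    push Not at hz
    obtain ⟨g, ⟨⟨hg1, hg2⟩, hgK⟩, hgd, hg0⟩ := hz
    have hψg : ψ g ≠ 0 := fun h => hg0 (hK g ⟨mem_sundial hb e1 e2 e0 eT g hgd hg1 hg2 h, hgK⟩ hgd)
    obtain ⟨v, hv⟩ : ∃ v, eval v g ≠ 0 := by
      by_contra! hc
      exact hg0 (MvPolynomial.funext (by simpa using hc))
    have hv0 : v ≠ 0 := by
      rintro rfl
      apply hv
      have := aeval_scale (A := k) g hgd 0 0
      rw [zero_pow (by omega), zero_mul] at this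
      simpa [MvPolynomial.aeval_eq_eval, Pi.zero_def] using this
    refine ⟨Submodule.span k {v}, finrank_span_singleton hv0, ?_⟩
    rintro f ⟨⟨⟨hf1, hf2⟩, hfR⟩, hfK⟩ hfd
    have hfv : eval v f = 0 := hfR v (Submodule.mem_span_singleton_self v)
    have hrel : C (ψ g) * f - C (ψ f) * g = 0 := by
      have hh : (C (ψ g) * f - C (ψ f) * g).IsHomogeneous d := by
        refine IsHomogeneous.sub ?_ ?_
        · exact hfd.C_mul _
        · exact hgd.C_mul _
      refine hK _ ⟨mem_sundial hb e1 e2 e0 eT _ hh ?_ ?_ ?_, ?_⟩ hh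
      · exact sub_mem (Ideal.mul_mem_left _ _ hf1) (Ideal.mul_mem_left _ _ hg1)
      · exact sub_mem (Ideal.mul_mem_left _ _ hf2) (Ideal.mul_mem_left _ _ hg2)
      · rw [← smul_eq_C_mul, ← smul_eq_C_mul, map_sub, map_smul, map_smul]
        simp [ψ]
        ring
      · exact sub_mem (Ideal.mul_mem_left _ _ hfK) (Ideal.mul_mem_left _ _ hgK)
    have h4 := congrArg (eval v) hrel
    simp [hfv, hv] at h4
    rw [h4] at hrel
    simpa [hψg] using hrel

/-- Division by `X` as a linear map. -/
noncomputable def divXLin (k : Type) [Field k] : Polynomial k →ₗ[k] Polynomial k where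
  toFun := Polynomial.divX
  map_add' _ _ := Polynomial.divX_add
  map_smul' c q := by
    ext i
    simp [Polynomial.coeff_divX]

theorem sundial_to_lines {k : Type} [Field k] [CharZero k] {N d : ℕ}
    {V₁ V₂ T : Submodule k (Fin N → k)} (hs : IsSundial k N V₁ V₂ T)
    (K : Ideal (MvPolynomial (Fin N) k)) (hK : ZeroIn d (sundialIdeal k N V₁ V₂ T ⊓ K)) :
    ∃ L : Submodule k (Fin N → k) × Submodule k (Fin N → k),
      (Module.finrank k L.1 = 2 ∧ Module.finrank k L.2 = 2) ∧
      ZeroIn d ((vanIdeal k N ↑L.1 ⊓ vanIdeal k N ↑L.2) ⊓ K) := by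
  obtain ⟨b, hb, e1, e2, e0, eT⟩ := sundial_basis hs
  let W : Submodule k (MvPolynomial (Fin N) k) :=
    Submodule.restrictScalars k (vanIdeal k N ↑V₁ ⊓ K) ⊓ homogeneousSubmodule (Fin N) k d
  have hfg : FiniteDimensional k (homogeneousSubmodule (Fin N) k d) :=
    Module.Finite.iff_fg.mpr (homogeneousSubmodule_fg (σ := Fin N) (R := k) d)
  have hW : FiniteDimensional k W := Submodule.finiteDimensional_of_le inf_le_right
  let Φ : Option (k × k) → W →ₗ[k] Polynomial k := fun o => match o with
    | none => (divXLin k).comp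
        ((lineMap (b 0) (b 3)).toLinearMap.comp W.subtype)
    | some (x, y) => (lineMap (x • b 0 + y • b 2) (x • b 3)).toLinearMap.comp W.subtype
  have hb0 : ∀ f : W, eval (b 0) (f : MvPolynomial (Fin N) k) = 0 := by
    intro f
    exact f.2.1.1 _ (by rw [e1]; exact Submodule.subset_span (by simp))
  have hdiv : ∀ f : W, lineMap (b 0) (b 3) (f : MvPolynomial (Fin N) k)
      = Polynomial.X * Φ none f := by
    intro f
    have h := Polynomial.X_mul_divX_add (lineMap (b 0) (b 3) (f : MvPolynomial (Fin N) k))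
    have hc : (lineMap (b 0) (b 3) (f : MvPolynomial (Fin N) k)).coeff 0 = 0 := by
      rw [Polynomial.coeff_zero_eq_eval_zero, lineMap_eval]
      simpa using hb0 f
    rw [hc, map_zero, add_zero] at h
    exact h.symm
  obtain ⟨t, ht, hinj⟩ := semicont Φ (by
    intro f hf
    apply Subtype.ext
    refine hK _ ⟨mem_sundial hb e1 e2 e0 eT _ f.2.2 f.2.1.1 ?_ ?_, f.2.1.2⟩ f.2.2
    · intro v hv
      rw [e2] at hv
      obtain ⟨x, y, rfl⟩ := Submodule.mem_span_pair.mp hv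
      have := hf (some (x, y))
      simp only [Φ, LinearMap.comp_apply, AlgHom.toLinearMap_apply, lineMap_eval] at this
      simpa using this
    · rw [hdiv f, Polynomial.coeff_X_mul, Polynomial.coeff_zero_eq_eval_zero]
      exact hf none)
  refine ⟨(V₁, Submodule.span k {b 0 + t • b 3, b 2}), ⟨hs.1, ?_⟩, ?_⟩
  · have hli : LinearIndependent k ![b 0 + t • b 3, b 2] := by
      rw [LinearIndependent.pair_iff]
      intro x y hxy
      have := Fintype.linearIndependent_iff.mp hb ![x, 0, y, x * t] (by
        rw [Fin.sum_univ_four]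
        simp
        rw [← hxy]
        module)
      exact ⟨by simpa using this 0, by simpa using this 2⟩
    exact finrank_pair hli
  · rintro f ⟨⟨hf1, hf2⟩, hfK⟩ hfd
    have := hinj ⟨f, ⟨hf1, hfK⟩, hfd⟩ (by
      rintro (_ | ⟨x, y⟩)
      · have h := congrArg (Polynomial.eval t) (hdiv ⟨f, ⟨hf1, hfK⟩, hfd⟩)
        rw [lineMap_eval, Polynomial.eval_mul, Polynomial.eval_X] at h
        have h' : eval (b 0 + t • b 3) f = 0 := hf2 _ (Submodule.subset_span (by simp))
        rw [h'] at h
        exact (mul_eq_zero.mp h.symm).resolve_left ht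
      · simp only [Φ, LinearMap.comp_apply, AlgHom.toLinearMap_apply, lineMap_eval]
        apply hf2
        refine Submodule.mem_span_pair.mpr ⟨x, y, ?_⟩
        module)
    exact congrArg Subtype.val this

theorem ts_bound (n d : ℕ) (hn : 3 ≤ n) : 2 * (d - 1) ≤ ((d+n).choose n + d) / (d+1) := by
  rw [Nat.le_div_iff_mul_le (by omega)]
  have h1 : (d+3).choose 3 ≤ (d+n).choose n := by
    rw [← Nat.choose_symm_add, ← Nat.choose_symm_add]
    exact Nat.choose_le_choose d (by omega)
  have h2 : (d+3).choose 3 * 6 = (d+1)*(d+2)*(d+3) := by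
    have := Nat.descFactorial_eq_factorial_mul_choose (d+3) 3
    simp [Nat.descFactorial, Nat.factorial] at this
    nlinarith
  rcases d with _ | e
  · simp
  · simp only [Nat.add_sub_cancel]
    zify at *
    nlinarith [mul_nonneg (by positivity : (0:ℤ) ≤ (e:ℤ)+2) (sq_nonneg (2*(e:ℤ) - 5))]

theorem split_iInf {α : Type*} [CompleteLattice α] {m a b c : ℕ} (hm : m = a + b + c)
    (S : Fin m → α) (Y : α) (ia : Fin a → Fin m) (ib : Fin b → Fin m) (ic : Fin c → Fin m)
    (ha : ∀ i, (ia i : ℕ) = i) (hb : ∀ i, (ib i : ℕ) = a + i)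
    (hc : ∀ i, (ic i : ℕ) = a + b + i) :
    (⨅ i, S (ib i)) ⊓ ((⨅ i, S (ic i)) ⊓ ((⨅ i, S (ia i)) ⊓ Y)) ≤ (⨅ i, S i) ⊓ Y := by
  refine le_inf (le_iInf fun i => ?_) (inf_le_right.trans (inf_le_right.trans inf_le_right))
  by_cases h1 : (i : ℕ) < a
  · have : ia ⟨i, h1⟩ = i := Fin.ext (ha _)
    have h := iInf_le (fun i => S (ia i)) ⟨i, h1⟩
    rw [this] at h
    exact inf_le_right.trans (inf_le_right.trans (inf_le_left.trans h))
  by_cases h2 : (i : ℕ) < a + b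
  · have hlt : (i : ℕ) - a < b := by omega
    have : ib ⟨i - a, hlt⟩ = i := Fin.ext (by rw [hb]; simp only; omega)
    have h := iInf_le (fun i => S (ib i)) ⟨i - a, hlt⟩
    rw [this] at h
    exact inf_le_left.trans h
  · have hlt : (i : ℕ) - (a + b) < c := by omega
    have : ic ⟨i - (a + b), hlt⟩ = i := Fin.ext (by rw [hc]; simp only; omega)
    have h := iInf_le (fun i => S (ic i)) ⟨i - (a + b), hlt⟩
    rw [this] at h
    exact inf_le_right.trans (inf_le_left.trans h)

theorem regroup {α : Type*} [CompleteLattice α] {ι κ μ : Type*} {A Y Z : α}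
    {P Q R : ι → α} {E F : κ → α} {G : μ → α}
    (hE : ∀ i, Z ≤ E i) (hF : ∀ i, Z ≤ F i) (hG : ∀ j, Z ≤ G j) (hY : Y = ⨅ j, G j) :
    A ⊓ (⨅ j, P j ⊓ Q j) ⊓ (⨅ j, R j) ⊓ Z
      ≤ (⨅ i, E i ⊓ F i) ⊓ ((⨅ i, P i ⊓ Q i ⊓ R i) ⊓ (A ⊓ Y)) := by
  subst hY
  refine le_inf (le_iInf fun i => ?_) (le_inf (le_iInf fun i => ?_) (le_inf ?_ ?_))
  · exact inf_le_right.trans (le_inf (hE i) (hF i))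
  · exact le_inf (inf_le_left.trans (inf_le_left.trans (inf_le_right.trans (iInf_le _ i))))
      (inf_le_left.trans (inf_le_right.trans (iInf_le _ i)))
  · exact inf_le_left.trans (inf_le_left.trans inf_le_left)
  · exact inf_le_right.trans (le_iInf fun j => hG j)

/-- Lemma 4.5(ii) of the paper: if statement `S*(n,d)` holds (generic sundials and
lines kill all forms of degree `d`), then so does `S*(n,d;a,b,c*)`. -/
theorem stmt12 (k : Type) [Field k] [IsAlgClosed k] [CharZero k]
    (n d a b cs ts : ℕ) (hn : 3 ≤ n) (hd : 1 ≤ d)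
    (hab : a + b ≤ d - 1) (hts : ts = ((d+n).choose n + d) / (d+1))
    (hcs : ts ≤ cs + 2*(a+b))
    (hS : ∃ (V₁ V₂ T : Fin (d-1) → Submodule k (Fin (n+1) → k))
        (M : Fin (ts - 2*(d-1)) → Submodule k (Fin (n+1) → k)),
        (∀ i, IsSundial k (n+1) (V₁ i) (V₂ i) (T i)) ∧
        (∀ j, Module.finrank k (M j) = 2) ∧
        hdim k (n+1) ((⨅ i, sundialIdeal k (n+1) (V₁ i) (V₂ i) (T i)) ⊓
          ⨅ j, vanIdeal k (n+1) ↑(M j)) d = 0) :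
    ∃ (V₁ V₂ T : Fin a → Submodule k (Fin (n+1) → k))
      (D₁ D₂ : Fin b → Submodule k (Fin (n+1) → k))
      (R : Fin b → Submodule k (Fin (n+1) → k))
      (M : Fin cs → Submodule k (Fin (n+1) → k)),
      (∀ i, IsSundial k (n+1) (V₁ i) (V₂ i) (T i)) ∧
      (∀ j, Module.finrank k (D₁ j) = 2 ∧ Module.finrank k (D₂ j) = 2 ∧
        D₁ j ≠ D₂ j ∧ Module.finrank k ↥(D₁ j ⊓ D₂ j) = 1) ∧
      (∀ j, Module.finrank k (R j) = 1) ∧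
      (∀ l, Module.finrank k (M l) = 2) ∧
      hdim k (n+1) ((⨅ i, sundialIdeal k (n+1) (V₁ i) (V₂ i) (T i)) ⊓
        (⨅ j, vanIdeal k (n+1) ↑(D₁ j) ⊓ vanIdeal k (n+1) ↑(D₂ j)) ⊓
        (⨅ j, vanIdeal k (n+1) ↑(R j)) ⊓
        ⨅ l, vanIdeal k (n+1) ↑(M l)) d = 0 := by
  subst hts
  have hbd := ts_bound n d hn
  generalize ((d+n).choose n + d) / (d+1) = ts at *
  obtain ⟨V₁, V₂, T, M, hsun, hM, hz⟩ := hS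
  rw [hdim_zero_iff] at hz
  obtain ⟨c, hc⟩ : ∃ c, d - 1 = a + b + c := ⟨d - 1 - (a + b), by omega⟩
  let ia : Fin a → Fin (d-1) := fun i => ⟨i, by omega⟩
  let ib : Fin b → Fin (d-1) := fun i => ⟨a + i, by omega⟩
  let ic : Fin c → Fin (d-1) := fun i => ⟨a + b + i, by omega⟩
  let S : Fin (d-1) → Ideal (MvPolynomial (Fin (n+1)) k) :=
    fun i => sundialIdeal k (n+1) (V₁ i) (V₂ i) (T i)
  have hz1 : ZeroIn d ((⨅ i, S (ib i)) ⊓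
      ((⨅ i, S (ic i)) ⊓ ((⨅ i, S (ia i)) ⊓ ⨅ j, vanIdeal k (n+1) ↑(M j)))) := by
    exact hz.mono (split_iInf hc S _ ia ib ic (fun _ => rfl) (fun _ => rfl) (fun _ => rfl))
  obtain ⟨R, hR, hz2⟩ := iterate_replace b (fun i => S (ib i))
    (fun i R => vanIdeal k (n+1) ↑(V₁ (ib i)) ⊓ vanIdeal k (n+1) ↑(V₂ (ib i)) ⊓
      vanIdeal k (n+1) ↑(R : Submodule k (Fin (n+1) → k)))
    (fun R => Module.finrank k R = 1)
    (fun i K hK => sundial_to_conic hd (hsun (ib i)) K hK) _ hz1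
  rw [inf_left_comm] at hz2
  obtain ⟨L, hL, hz3⟩ := iterate_replace c (fun i => S (ic i))
    (fun i (L : Submodule k (Fin (n+1) → k) × Submodule k (Fin (n+1) → k)) =>
      vanIdeal k (n+1) ↑L.1 ⊓ vanIdeal k (n+1) ↑L.2)
    (fun L => Module.finrank k L.1 = 2 ∧ Module.finrank k L.2 = 2)
    (fun i K hK => sundial_to_lines (hsun (ic i)) K hK) _ hz2
  let lines : Fin (ts - 2*(d-1)) ⊕ (Fin c ⊕ Fin c) → Submodule k (Fin (n+1) → k) :=
    Sum.elim M (Sum.elim (fun i => (L i).1) (fun i => (L i).2))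
  have hlines : ∀ x, Module.finrank k (lines x) = 2 := by
    rintro (x | x | x)
    exacts [hM x, (hL x).1, (hL x).2]
  obtain ⟨e⟩ : Nonempty ((Fin (ts - 2*(d-1)) ⊕ (Fin c ⊕ Fin c)) ↪ Fin cs) := by
    apply Function.Embedding.nonempty_of_card_le
    simp
    omega
  obtain ⟨L0, hL0⟩ : ∃ L0 : Submodule k (Fin (n+1) → k), Module.finrank k L0 = 2 := by
    have hli : LinearIndependent k (fun i : Fin 2 =>
        (Pi.basisFun k (Fin (n+1)) (Fin.castLE (by omega) i))) :=
      (Pi.basisFun k (Fin (n+1))).linearIndependent.comp _ (Fin.castLE_injective _)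
    exact ⟨_, (finrank_span_eq_card hli).trans (by simp)⟩
  refine ⟨fun i => V₁ (ia i), fun i => V₂ (ia i), fun i => T (ia i), fun i => V₁ (ib i),
    fun i => V₂ (ib i), R, Function.extend e lines (fun _ => L0), fun i => hsun _,
    fun j => ⟨(hsun (ib j)).1, (hsun (ib j)).2.1, (hsun (ib j)).2.2.1, (hsun (ib j)).2.2.2.1⟩,
    hR, fun l => ?_, ?_⟩
  · by_cases h : ∃ x, e x = l
    · obtain ⟨x, rfl⟩ := h
      rw [e.injective.extend_apply]
      exact hlines x
    · rw [Function.extend_apply' _ _ _ h]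
      exact hL0
  · rw [hdim_zero_iff]
    have hl : ∀ x, (⨅ l, vanIdeal k (n+1) ↑(Function.extend e lines (fun _ => L0) l))
        ≤ vanIdeal k (n+1) ↑(lines x) := by
      intro x
      refine (iInf_le _ (e x)).trans ?_
      rw [e.injective.extend_apply]
    exact hz3.mono (regroup (fun i => hl (Sum.inr (Sum.inl i))) (fun i => hl (Sum.inr (Sum.inr i)))
      (fun j => hl (Sum.inl j)) rfl)
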